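/- Let X_n = O((ξ_n,q_n)) be a sequence of T-periodic orbits with repetitive pattern, and let A_n be the sets defined below from a choice of intervals J'_n. Then there exists ρ > 0 such that μ_{X_n}(Σ_k × A_n) ≥ ρ for every n ≥ 1, where μ_{X_n} = (1/π_n) Σ_{ℓ=0}^{π_n−1} δ_{T^ℓ(ξ_n,q_n)}. -/

import Mathlib

open MeasureTheory Filter Set
open scoped ENNReal NNReal

noncomputable section

/-- The two-sided full shift space on `k` symbols. -/
abbrev Shift (k : ℕ) := ℤ → Fin k

/-- The shift map `σ`. -/
def shiftMap (k : ℕ) : Shift k → Shift k := fun ξ i => ξ (i + 1)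

/-- The circle `S¹`, modelled as `ℝ/ℤ`. -/
abbrev Circle1 := AddCircle (1 : ℝ)

/-- The phase space `M = Σ_k × S¹`. -/
abbrev SkewM (k : ℕ) := Shift k × Circle1

/-- Canonical projection `ℝ → S¹`. -/
def projCircle : ℝ → Circle1 := fun x => (x : Circle1)

/-- A locally constant skew product system over the full shift with circle fibers:
the fiber maps `f j` are `C¹` diffeomorphisms of the circle, recorded together with
lifts `F j : ℝ → ℝ`. -/
structure SkewSetup (k : ℕ) where
  f : Fin k → Circle1 → Circle1
  F : Fin k → ℝ → ℝ
  compat : ∀ j (x : ℝ), f j (projCircle x) = projCircle (F j x)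
  F_equiv : ∀ j x, F j (x + 1) = F j x + 1
  F_smooth : ∀ j, ContDiff ℝ 1 (F j)
  F_bij : ∀ j, Function.Bijective (F j)
  Finv_smooth : ∀ j, ContDiff ℝ 1 (Function.invFun (F j))

/-- The skew product map `T(ξ,x) = (σξ, f_{ξ₀} x)`. -/
def SkewSetup.T {k : ℕ} (S : SkewSetup k) : SkewM k → SkewM k :=
  fun z => (shiftMap k z.1, S.f (z.1 0) z.2)

/-- The composition `f_{w (m-1)} ∘ ⋯ ∘ f_{w 0}` of the fiber maps along a word `w`. -/
def SkewSetup.wordComp {k : ℕ} (S : SkewSetup k) (w : ℕ → Fin k) : ℕ → Circle1 → Circle1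
  | 0 => id
  | m + 1 => S.f (w m) ∘ S.wordComp w m

/-- The corresponding composition of the lifts. -/
def SkewSetup.wordCompLift {k : ℕ} (S : SkewSetup k) (w : ℕ → Fin k) : ℕ → ℝ → ℝ
  | 0 => id
  | m + 1 => S.F (w m) ∘ S.wordCompLift w m

/-- A sequence of `T`-periodic orbits with repetitive pattern (Definition 2.2 of the paper).
The `n`-th periodic point is `(ξ n, q n)` where `ξ n` is the infinite repetition of the
word `w n 0, …, w n (π n - 1)`; the intervals `J n ⊆ S¹` are the arcs
`projCircle '' Icc (a n) (b n)`. -/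
structure RepetitivePattern {k : ℕ} (S : SkewSetup k) where
  /-- the periods -/
  π : ℕ → ℕ
  π_pos : ∀ n, 0 < π n
  /-- the words (`w n i` is the letter `ω^n_{i+1}` of the paper) -/
  w : ℕ → ℕ → Fin k
  /-- the fiber coordinates of the periodic points -/
  q : ℕ → Circle1
  /-- endpoints of (lifts of) the intervals `J n` -/
  a : ℕ → ℝ
  b : ℕ → ℝ
  a_lt_b : ∀ n, a n < b n
  nested : ∀ n, Icc (a (n + 1)) (b (n + 1)) ⊆ Icc (a n) (b n)
  len_lt : ∀ n, b (n + 1) - a (n + 1) < b n - a n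
  len_to_zero : Tendsto (fun n => b n - a n) atTop (nhds 0)
  q_mem : ∀ n, q n ∈ projCircle '' Icc (a n) (b n)
  /-- `J 0, f_{ω^0_1}(J 0), …, f_{ω^0_{π 0 - 1}}∘⋯∘f_{ω^0_1}(J 0)` are pairwise disjoint -/
  disjoint0 : ∀ ℓ₁ ℓ₂, ℓ₁ < ℓ₂ → ℓ₂ < π 0 →
    Disjoint (S.wordComp (w 0) ℓ₁ '' (projCircle '' Icc (a 0) (b 0)))
             (S.wordComp (w 0) ℓ₂ '' (projCircle '' Icc (a 0) (b 0)))
  /-- `q n` is fixed by `g n = f_{ω^n_{π n}} ∘ ⋯ ∘ f_{ω^n_1}` -/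
  fixed : ∀ n, S.wordComp (w n) (π n) (q n) = q n
  /-- `|g_n'| < 1` on `J n` -/
  contracting : ∀ n, ∀ x ∈ Icc (a n) (b n), |deriv (S.wordCompLift (w n) (π n)) x| < 1
  /-- the numbers `k_n` (for `n ≥ 1`) -/
  kseq : ℕ → ℕ
  /-- the numbers `R_n` (for `n ≥ 1`) -/
  Rseq : ℕ → ℕ
  kseq_ge : ∀ n, 2 ≤ kseq (n + 1)
  Rseq_ge : ∀ n, 1 ≤ Rseq (n + 1)
  /-- `g (n+1) = T_{R (n+1)} ∘ (g n)^{k (n+1)}`, encoded on the level of words: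
  the word of `ξ (n+1)` is `k (n+1)` repetitions of the word of `ξ n` followed by a
  word of length `R (n+1)` -/
  period_eq : ∀ n, π (n + 1) = kseq (n + 1) * π n + Rseq (n + 1)
  word_eq : ∀ n, ∀ i < kseq (n + 1) * π n, w (n + 1) i = w n (i % π n)
  /-- the sequence `λ_n = R_n / (k_n π_{n-1})` is summable -/
  lam_summable : Summable fun n => (Rseq (n + 1) : ℝ) / (kseq (n + 1) * π n)

namespace RepetitivePattern

variable {k : ℕ} {S : SkewSetup k}

/-- The `σ`-periodic point `ξ n`, the infinite repetition of the `n`-th word. -/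
def ξp (P : RepetitivePattern S) (n : ℕ) : Shift k :=
  fun i => P.w n (Int.toNat (i % (P.π n : ℤ)))

/-- The measure `μ_{X_n}`, uniformly distributed on the `n`-th periodic orbit. -/
def μX (P : RepetitivePattern S) (n : ℕ) : Measure (SkewM k) :=
  (P.π n : ℝ≥0∞)⁻¹ • ∑ ℓ ∈ Finset.range (P.π n), Measure.dirac (S.T^[ℓ] (P.ξp n, P.q n))

/-- The projected measure `ν_n`, uniformly distributed on the `σ`-orbit of `ξ n`. -/
def νX (P : RepetitivePattern S) (n : ℕ) : Measure (Shift k) :=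
  (P.π n : ℝ≥0∞)⁻¹ • ∑ ℓ ∈ Finset.range (P.π n), Measure.dirac ((shiftMap k)^[ℓ] (P.ξp n))

end RepetitivePattern

/-- Weak-star convergence of a sequence of measures. -/
def WeakStarTendsto {X : Type*} [TopologicalSpace X] [MeasurableSpace X]
    (μs : ℕ → Measure X) (μ : Measure X) : Prop :=
  ∀ g : C(X, ℝ), Tendsto (fun n => ∫ x, g x ∂(μs n)) atTop (nhds (∫ x, g x ∂μ))

/-- A probability measure on `M` has periodic repetitive pattern if it is the weak-star
limit of the measures `μ_{X_n}` for some sequence of periodic orbits with repetitive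
pattern. -/
def HasPeriodicRepetitivePattern {k : ℕ} (S : SkewSetup k) (μ : Measure (SkewM k)) : Prop :=
  ∃ P : RepetitivePattern S, WeakStarTendsto (fun n => P.μX n) μ

/-- The Kolmogorov–Sinai (measure-theoretic) entropy of `T` with respect to `μ`:
the supremum, over all finite measurable colorings `c : X → Fin m`, of the entropy of the
associated process, the latter being computed (via subadditivity) as the infimum of
`H_n/n` where `H_n` is the Shannon entropy of the partition of `X` according to the
itinerary `(c x, c (T x), …, c (T^{n-1} x))`. -/
def ksEntropy {X : Type*} [MeasurableSpace X] (T : X → X) (μ : Measure X) : ℝ≥0∞ :=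
  ⨆ (m : ℕ) (c : {c : X → Fin m // Measurable c}),
    ⨅ n : ℕ, ENNReal.ofReal
      ((∑ s : Fin (n + 1) → Fin m,
        Real.negMulLog ((μ {x | ∀ i : Fin (n + 1), c.1 (T^[(i : ℕ)] x) = s i}).toReal))
        / ((n : ℝ) + 1))


namespace RepetitivePattern

variable {k : ℕ} {S : SkewSetup k}

/-- The map `g n = f_{ω^n_{π n}} ∘ ⋯ ∘ f_{ω^n_1}`. -/
def g (P : RepetitivePattern S) (n : ℕ) : Circle1 → Circle1 :=
  S.wordComp (P.w n) (P.π n)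

/-- The composition `g_0^{ℓ 1} ∘ g_1^{ℓ 2} ∘ ⋯ ∘ g_{n-1}^{ℓ n}`. -/
def multiComp (P : RepetitivePattern S) : ℕ → (ℕ → ℕ) → Circle1 → Circle1
  | 0, _ => id
  | n + 1, ℓ => P.multiComp n ℓ ∘ (P.g n)^[ℓ (n + 1)]

/-- The set `I_n(J') = ⋃_{ℓ_n=0}^{k_n} ⋯ ⋃_{ℓ_1=0}^{k_1} g_0^{ℓ_1}∘⋯∘g_{n-1}^{ℓ_n}(J')`. -/
def Iset (P : RepetitivePattern S) (n : ℕ) (J' : Set Circle1) : Set Circle1 :=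
  ⋃ (ℓ : ℕ → ℕ) (_ : ∀ i, 1 ≤ i → i ≤ n → ℓ i ≤ P.kseq i), P.multiComp n ℓ '' J'

/-- The set `A_n(J') = I_n(J') ∪ ⋃_{ℓ=1}^{π_0} f_{ω^0_ℓ}∘⋯∘f_{ω^0_1}(I_n(J'))`. -/
def Aset (P : RepetitivePattern S) (n : ℕ) (J' : Set Circle1) : Set Circle1 :=
  P.Iset n J' ∪
    ⋃ (ℓ : ℕ) (_ : 1 ≤ ℓ) (_ : ℓ ≤ P.π 0), S.wordComp (P.w 0) ℓ '' P.Iset n J'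

/-- `λ_n = R_n / (k_n π_{n-1})`. -/
def lam (P : RepetitivePattern S) (n : ℕ) : ℝ :=
  (P.Rseq n : ℝ) / ((P.kseq n : ℝ) * (P.π (n - 1) : ℝ))

end RepetitivePattern

/-- The composition along a word depends only on the letters that are used. -/
theorem SkewSetup.wordComp_congr {k : ℕ} (S : SkewSetup k) {w w' : ℕ → Fin k} {m : ℕ}
    (h : ∀ i < m, w i = w' i) : S.wordComp w m = S.wordComp w' m := by
  induction m with
  | zero => rfl
  | succ m ih =>
    simp only [SkewSetup.wordComp]
    rw [h m (Nat.lt_succ_self m), ih fun i hi => h i (hi.trans (Nat.lt_succ_self m))]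

theorem SkewSetup.wordComp_add {k : ℕ} (S : SkewSetup k) (w : ℕ → Fin k) (m n : ℕ) :
    S.wordComp w (m + n) = S.wordComp (fun i => w (m + i)) n ∘ S.wordComp w m := by
  induction n with
  | zero => rfl
  | succ n ih =>
    rw [← add_assoc]
    simp only [SkewSetup.wordComp]
    rw [ih, Function.comp_assoc]

/-- The composition along the `p`-periodic extension of a word. -/
theorem SkewSetup.wordComp_mod {k : ℕ} (S : SkewSetup k) (w : ℕ → Fin k) (p m s : ℕ)
    (hs : s ≤ p) :
    S.wordComp (fun i => w (i % p)) (m * p + s) = S.wordComp w s ∘ (S.wordComp w p)^[m] := by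
  have key : ∀ m s, s ≤ p → S.wordComp (fun i => w ((m * p + i) % p)) s = S.wordComp w s := by
    intro m s hs
    refine S.wordComp_congr fun i hi => ?_
    rw [Nat.mul_add_mod_of_lt (hi.trans_le hs)]
  rw [S.wordComp_add, key m s hs]
  congr 1
  induction m with
  | zero => rw [Nat.zero_mul]; rfl
  | succ m ih => rw [Nat.succ_mul, S.wordComp_add, key m p le_rfl, ih, Function.iterate_succ']

theorem SkewSetup.iterate_T {k : ℕ} (S : SkewSetup k) (ξ : Shift k) (x : Circle1) (t : ℕ) :
    S.T^[t] (ξ, x) = (fun i => ξ (i + t), S.wordComp (fun i => ξ i) t x) := by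
  induction t with
  | zero => simp [SkewSetup.wordComp]
  | succ t ih =>
    rw [Function.iterate_succ_apply', ih]
    simp only [SkewSetup.T, SkewSetup.wordComp, Function.comp_apply, zero_add]
    congr 1
    funext i
    simp only [shiftMap]
    congr 1
    push_cast
    ring

namespace RepetitivePattern

variable {k : ℕ} {S : SkewSetup k}

/-- The times `t < π n` at which the composition along the `n`-th word factors as
`f_{ω^0_r} ∘ ⋯ ∘ f_{ω^0_1} ∘ g_0^{ℓ 1} ∘ ⋯ ∘ g_{n-1}^{ℓ n}` with admissible exponents. -/
def IsGoodTime (P : RepetitivePattern S) (n t : ℕ) : Prop :=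
  t < P.π n ∧ ∃ r < P.π 0, ∃ ℓ : ℕ → ℕ, (∀ i, 1 ≤ i → i ≤ n → ℓ i ≤ P.kseq i) ∧
    S.wordComp (P.w n) t = S.wordComp (P.w 0) r ∘ P.multiComp n ℓ

open Classical in
/-- The finite set of good times. -/
def goodTimes (P : RepetitivePattern S) (n : ℕ) : Finset ℕ :=
  (Finset.range (P.π n)).filter (P.IsGoodTime n)

theorem mem_goodTimes (P : RepetitivePattern S) {n t : ℕ} :
    t ∈ P.goodTimes n ↔ P.IsGoodTime n t := by
  classical
  simp only [goodTimes, Finset.mem_filter, Finset.mem_range, and_iff_right_iff_imp]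
  exact fun h => h.1

theorem multiComp_congr (P : RepetitivePattern S) {n : ℕ} {ℓ ℓ' : ℕ → ℕ}
    (h : ∀ i, i ≤ n → ℓ i = ℓ' i) : P.multiComp n ℓ = P.multiComp n ℓ' := by
  induction n with
  | zero => rfl
  | succ n ih =>
    simp only [multiComp]
    rw [ih fun i hi => h i (hi.trans n.le_succ), h (n + 1) le_rfl]

theorem IsGoodTime.succ {P : RepetitivePattern S} {n s m : ℕ} (h : P.IsGoodTime n s)
    (hm : m < P.kseq (n + 1)) : P.IsGoodTime (n + 1) (m * P.π n + s) := by
  obtain ⟨hs, r, hr, ℓ, hℓ, he⟩ := h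
  have hlt : m * P.π n + s < P.kseq (n + 1) * P.π n :=
    calc m * P.π n + s < (m + 1) * P.π n := by rw [Nat.succ_mul]; omega
      _ ≤ _ := Nat.mul_le_mul_right _ hm
  refine ⟨?_, r, hr, Function.update ℓ (n + 1) m, ?_, ?_⟩
  · rw [P.period_eq]; omega
  · intro i h1 hi
    rcases eq_or_ne i (n + 1) with rfl | hne
    · simpa using hm.le
    · rw [Function.update_of_ne hne]
      exact hℓ i h1 (by omega)
  · rw [S.wordComp_congr fun i hi => P.word_eq n i (hi.trans hlt), S.wordComp_mod _ _ _ _ hs.le, he]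
    simp only [multiComp, Function.update_self]
    have hne : ∀ i, i ≤ n → Function.update ℓ (n + 1) m i = ℓ i := fun i hi =>
      Function.update_of_ne (by omega) _ _
    rw [P.multiComp_congr hne]
    rfl

theorem goodTimes_zero (P : RepetitivePattern S) : P.goodTimes 0 = Finset.range (P.π 0) := by
  ext t
  rw [mem_goodTimes, Finset.mem_range]
  exact ⟨fun h => h.1, fun h => ⟨h, t, h, 0, fun i h1 h0 => by omega, rfl⟩⟩

theorem card_goodTimes_succ (P : RepetitivePattern S) (n : ℕ) :
    P.kseq (n + 1) * (P.goodTimes n).card ≤ (P.goodTimes (n + 1)).card := by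
  rw [← Finset.card_range (P.kseq (n + 1)), ← Finset.card_product]
  refine Finset.card_le_card_of_injOn (fun p => p.1 * P.π n + p.2) ?_ ?_
  · rintro ⟨m, s⟩ h
    simp only [Finset.coe_product, Set.mem_prod, Finset.mem_coe, Finset.mem_range,
      mem_goodTimes] at h ⊢
    exact h.2.succ h.1
  · rintro ⟨m, s⟩ h ⟨m', s'⟩ h' he
    simp only [Finset.coe_product, Set.mem_prod, Finset.mem_coe, mem_goodTimes] at h h'
    have hs := h.2.1
    have hs' := h'.2.1
    simp only at he hs hs'
    have e1 : s = s' := by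
      simpa [Nat.mod_eq_of_lt hs, Nat.mod_eq_of_lt hs'] using congrArg (· % P.π n) he
    subst e1
    have e2 := Nat.eq_of_mul_eq_mul_right (P.π_pos n) (Nat.add_right_cancel he)
    rw [e2]

theorem period_le_card_goodTimes_mul_exp (P : RepetitivePattern S) (n : ℕ) :
    (P.π n : ℝ) ≤ (P.goodTimes n).card *
      Real.exp (∑ i ∈ Finset.range n, (P.Rseq (i + 1) : ℝ) / (P.kseq (i + 1) * P.π i)) := by
  induction n with
  | zero => simp [goodTimes_zero]
  | succ n ih =>
    rw [Finset.sum_range_succ, Real.exp_add]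
    set E := Real.exp (∑ i ∈ Finset.range n, (P.Rseq (i + 1) : ℝ) / (P.kseq (i + 1) * P.π i))
    set l := (P.Rseq (n + 1) : ℝ) / (P.kseq (n + 1) * P.π n) with hl
    have hk : (0 : ℝ) < P.kseq (n + 1) := by
      have := P.kseq_ge n
      exact_mod_cast (by omega : 0 < P.kseq (n + 1))
    have hπ : (0 : ℝ) < P.π n := by exact_mod_cast P.π_pos n
    have hcard : (P.kseq (n + 1) : ℝ) * (P.goodTimes n).card ≤ (P.goodTimes (n + 1)).card := by
      exact_mod_cast P.card_goodTimes_succ n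
    calc (P.π (n + 1) : ℝ) = P.kseq (n + 1) * P.π n * (l + 1) := by
          rw [P.period_eq, hl]; push_cast; field_simp; ring
      _ ≤ P.kseq (n + 1) * ((P.goodTimes n).card * E) * Real.exp l := by
          gcongr
          exact Real.add_one_le_exp l
      _ = P.kseq (n + 1) * (P.goodTimes n).card * (E * Real.exp l) := by ring
      _ ≤ (P.goodTimes (n + 1)).card * (E * Real.exp l) := by gcongr

theorem iterate_T_snd (P : RepetitivePattern S) {n t : ℕ} (ht : t < P.π n) (x : Circle1) :
    (S.T^[t] (P.ξp n, x)).2 = S.wordComp (P.w n) t x := by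
  rw [S.iterate_T]
  refine congrFun (S.wordComp_congr fun i hi => ?_) x
  simp only [ξp]
  congr 1
  rw [← Int.natCast_mod, Int.toNat_natCast, Nat.mod_eq_of_lt (hi.trans ht)]

theorem IsGoodTime.mem_Aset {P : RepetitivePattern S} {n t : ℕ} (h : P.IsGoodTime n t)
    {J : Set Circle1} (hq : P.q n ∈ J) : (S.T^[t] (P.ξp n, P.q n)).2 ∈ P.Aset n J := by
  obtain ⟨ht, r, hr, ℓ, hℓ, he⟩ := h
  rw [P.iterate_T_snd ht, he, Function.comp_apply]
  have hI : P.multiComp n ℓ (P.q n) ∈ P.Iset n J := mem_iUnion₂.2 ⟨ℓ, hℓ, mem_image_of_mem _ hq⟩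
  rcases Nat.eq_zero_or_pos r with rfl | hr0
  · exact Or.inl hI
  · refine Or.inr (mem_iUnion₂.2 ⟨r, hr0, mem_iUnion.2 ⟨hr.le, mem_image_of_mem _ hI⟩⟩)

theorem card_goodTimes_le_μX (P : RepetitivePattern S) {n : ℕ} {J : Set Circle1}
    (hq : P.q n ∈ J) :
    (P.π n : ℝ≥0∞)⁻¹ * (P.goodTimes n).card ≤
      P.μX n ((Set.univ : Set (Shift k)) ×ˢ P.Aset n J) := by
  classical
  rw [μX, Measure.smul_apply, Measure.finsetSum_apply, smul_eq_mul]
  gcongr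
  calc ((P.goodTimes n).card : ℝ≥0∞) = ∑ t ∈ P.goodTimes n, 1 := by simp
    _ ≤ ∑ t ∈ P.goodTimes n, Measure.dirac (S.T^[t] (P.ξp n, P.q n))
          ((Set.univ : Set (Shift k)) ×ˢ P.Aset n J) := by
        refine Finset.sum_le_sum fun t ht => ?_
        rw [Measure.dirac_apply_of_mem]
        exact ⟨mem_univ _, (P.mem_goodTimes.1 ht).mem_Aset hq⟩
    _ ≤ _ := Finset.sum_le_sum_of_subset (Finset.filter_subset _ _)

end RepetitivePattern

/-- For a sequence of periodic orbits with repetitive pattern and the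
associated sets `A_n`, there is `ρ > 0` with `μ_{X_n}(Σ_k × A_n) ≥ ρ` for all `n ≥ 1`. -/
theorem measure_of_strips_uniformly_positive
    {k : ℕ} (S : SkewSetup k) (P : RepetitivePattern S)
    (J' : ℕ → Set Circle1)
    (hJ'arc : ∀ n, 1 ≤ n → ∃ c d : ℝ, c ≤ d ∧ J' n = projCircle '' Icc c d)
    (hJ'q : ∀ n, 1 ≤ n → P.q n ∈ J' n)
    (hJ'sub : ∀ n, 1 ≤ n → J' n ⊆ projCircle '' Icc (P.a n) (P.b n))
    (hJ'sup : ∀ n, 1 ≤ n → projCircle '' Icc (P.a (n + 1)) (P.b (n + 1)) ⊆ J' n) :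
    ∃ ρ : ℝ≥0∞, 0 < ρ ∧ ∀ n, 1 ≤ n →
      ρ ≤ P.μX n ((Set.univ : Set (Shift k)) ×ˢ P.Aset n (J' n)) := by
  refine ⟨ENNReal.ofReal (Real.exp (-∑' i, (P.Rseq (i + 1) : ℝ) / (P.kseq (i + 1) * P.π i))),
    ENNReal.ofReal_pos.2 (Real.exp_pos _), fun n hn =>
      le_trans ?_ (P.card_goodTimes_le_μX (hJ'q n hn))⟩
  have hπ : (0 : ℝ) < P.π n := by exact_mod_cast P.π_pos n
  have hle : (P.π n : ℝ) ≤ (P.goodTimes n).card *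
      Real.exp (∑' i, (P.Rseq (i + 1) : ℝ) / (P.kseq (i + 1) * P.π i)) := by
    refine (P.period_le_card_goodTimes_mul_exp n).trans ?_
    gcongr
    exact P.lam_summable.sum_le_tsum _ fun i _ => by positivity
  rw [← ENNReal.ofReal_natCast (P.π n), ← ENNReal.ofReal_natCast (P.goodTimes n).card,
    ← ENNReal.ofReal_inv_of_pos hπ, ← ENNReal.ofReal_mul (by positivity)]
  refine ENNReal.ofReal_le_ofReal ?_
  rw [Real.exp_neg, inv_mul_eq_div, le_div_iff₀ hπ, inv_mul_le_iff₀ (Real.exp_pos _)]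
  linarith

end
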